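/- arXiv:1908.09012 — 2 statements merged into one kernel-verified Lean document; each statement's English description precedes it below -/
import Mathlib

section
/- Hájek–Rényi–Chow maximal inequality (probability form): let (Ω, ℱ, μ) be a probability space with a filtration (ℱ_i)_{i ≥ 1}, and let (Y_i)_{i ≥ 1} be a submartingale with respect to (ℱ_i). Let (a_i)_{i ≥ 1} be a non-decreasing sequence of positive real numbers and let λ > 0 be a real number. Then for every n ≥ 1: λ · μ{ ω : ∃ i, 1 ≤ i ≤ n, Y_i(ω)/a_i ≥ λ } ≤ E[Y_1⁺]/a_1 + Σ_{i=1}^{n−1} ( E[Y_{i+1}⁺] − E[Y_i⁺] ) / a_{i+1}. -/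
open MeasureTheory Filter

theorem hrc_step {Ω : Type*} {m0 : MeasurableSpace Ω} {μ : Measure Ω} [IsProbabilityMeasure μ]
    (y : Ω → ℝ) (hy : Measurable y) (hi : Integrable y μ) (a lam : ℝ) (ha : 0 < a)
    (C : Set Ω) (hC : MeasurableSet C) :
    lam * μ.real (C ∩ {ω | lam ≤ y ω / a}) + (∫ ω in C \ {ω | lam ≤ y ω / a}, max (y ω) 0 ∂μ) / a
      ≤ (∫ ω in C, max (y ω) 0 ∂μ) / a := by
  have hD : MeasurableSet {ω | lam ≤ y ω / a} :=
    measurableSet_le measurable_const (hy.div_const a)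
  have hX : Integrable (fun ω => max (y ω) 0) μ := hi.pos_part
  rw [← integral_inter_add_sdiff (s := C) hD hX.integrableOn, add_div]
  refine add_le_add ?_ le_rfl
  rw [le_div_iff₀ ha]
  have h1 : ∫ ω in C ∩ {ω | lam ≤ y ω / a}, lam * a ∂μ
      ≤ ∫ ω in C ∩ {ω | lam ≤ y ω / a}, max (y ω) 0 ∂μ := by
    refine setIntegral_mono_on (integrable_const _).integrableOn hX.integrableOn (hC.inter hD) ?_
    intro ω hω
    have h2 : lam ≤ y ω / a := hω.2
    rw [le_div_iff₀ ha] at h2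
    exact h2.trans (le_max_left _ _)
  rw [setIntegral_const, smul_eq_mul] at h1
  linarith

theorem hrc_sub {Ω : Type*} {m0 : MeasurableSpace Ω} {μ : Measure Ω} [IsProbabilityMeasure μ]
    (ℱ : Filtration ℕ m0) (Y : ℕ → Ω → ℝ)
    (hadp : ∀ i, 1 ≤ i → StronglyMeasurable[ℱ i] (Y i))
    (hint : ∀ i, 1 ≤ i → Integrable (Y i) μ)
    (hsub : ∀ i j, 1 ≤ i → i ≤ j → Y i ≤ᵐ[μ] μ[Y j | ℱ i])
    (n : ℕ) (hn : 1 ≤ n) (s : Set Ω) (hs : MeasurableSet[ℱ n] s) :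
    ∫ ω in s, max (Y n ω) 0 ∂μ ≤ ∫ ω in s, max (Y (n + 1) ω) 0 ∂μ := by
  let G : Filtration ℕ m0 := ⟨fun i => ℱ (i + 1), fun i j h => ℱ.mono (by omega), fun i => ℱ.le _⟩
  have hZ : Submartingale (fun i => Y (i + 1)) G μ :=
    ⟨fun i => hadp (i + 1) (by omega), fun i j h => hsub (i + 1) (j + 1) (by omega) (by omega),
      fun i => hint (i + 1) (by omega)⟩
  obtain ⟨k, rfl⟩ : ∃ k, n = k + 1 := ⟨n - 1, by omega⟩
  exact hZ.pos.setIntegral_le (i := k) (j := k + 1) (by omega) hs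

/-- The Hájek–Rényi–Chow maximal inequality, probability form. -/
theorem hajek_renyi_chow_maximal_inequality_prob
    {Ω : Type*} {m0 : MeasurableSpace Ω} {μ : Measure Ω} [IsProbabilityMeasure μ]
    (ℱ : Filtration ℕ m0) (Y : ℕ → Ω → ℝ)
    (hadp : ∀ i, 1 ≤ i → StronglyMeasurable[ℱ i] (Y i))
    (hint : ∀ i, 1 ≤ i → Integrable (Y i) μ)
    (hsub : ∀ i j, 1 ≤ i → i ≤ j → Y i ≤ᵐ[μ] μ[Y j | ℱ i])
    (a : ℕ → ℝ) (hapos : ∀ i, 1 ≤ i → 0 < a i)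
    (hamono : ∀ i j, 1 ≤ i → i ≤ j → a i ≤ a j)
    (lam : ℝ) (hlam : 0 < lam) (n : ℕ) (hn : 1 ≤ n) :
    lam * (μ {ω | ∃ i, 1 ≤ i ∧ i ≤ n ∧ lam ≤ Y i ω / a i}).toReal ≤
      (∫ ω, max (Y 1 ω) 0 ∂μ) / a 1 +
        ∑ i ∈ Finset.Ico 1 n,
          ((∫ ω, max (Y (i + 1) ω) 0 ∂μ) - ∫ ω, max (Y i ω) 0 ∂μ) / a (i + 1) := by
  have hmeas : ∀ i, 1 ≤ i → Measurable (Y i) := fun i hi => ((hadp i hi).mono (ℱ.le i)).measurable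
  have hX : ∀ i, 1 ≤ i → Integrable (fun ω => max (Y i ω) 0) μ := fun i hi => (hint i hi).pos_part
  let E : ℕ → Set Ω := fun n => {ω | ∃ i, 1 ≤ i ∧ i ≤ n ∧ lam ≤ Y i ω / a i}
  have hE : ∀ n, MeasurableSet[ℱ n] (E n) := by
    intro n
    have : E n = ⋃ i ∈ Set.Icc 1 n, {ω | lam ≤ Y i ω / a i} := by
      ext ω; simp [E, and_assoc]
    rw [this]
    refine MeasurableSet.biUnion (Set.to_countable _) fun i hi => ?_
    have h1 : Measurable[ℱ n] (Y i) := ((hadp i hi.1).mono (ℱ.mono hi.2)).measurable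
    exact @measurableSet_le _ _ _ _ _ (ℱ n) _ _ _ _ _ measurable_const (h1.div_const _)
  have hE' : ∀ n, MeasurableSet (E n) := fun n => ℱ.le n _ (hE n)
  have hsucc : ∀ n, E (n + 1) = E n ∪ ((E n)ᶜ ∩ {ω | lam ≤ Y (n + 1) ω / a (n + 1)}) := by
    intro n
    rw [Set.union_inter_distrib_left, Set.union_compl_self, Set.univ_inter]
    ext ω
    constructor
    · rintro ⟨i, h1, h2, h3⟩
      rcases Nat.lt_or_ge n i with h | h
      · obtain rfl : i = n + 1 := by omega
        exact Or.inr h3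
      · exact Or.inl ⟨i, h1, h, h3⟩
    · rintro (⟨i, h1, h2, h3⟩ | h)
      · exact ⟨i, h1, by omega, h3⟩
      · exact ⟨n + 1, by omega, le_rfl, h⟩
  have hcompl : ∀ n, (E (n + 1))ᶜ = (E n)ᶜ \ {ω | lam ≤ Y (n + 1) ω / a (n + 1)} := by
    intro n
    rw [hsucc]
    ext ω
    simp only [Set.mem_compl_iff, Set.mem_union, Set.mem_inter_iff, Set.mem_sdiff]
    tauto
  have hmu : ∀ n, μ.real (E (n + 1)) =
      μ.real (E n) + μ.real ((E n)ᶜ ∩ {ω | lam ≤ Y (n + 1) ω / a (n + 1)}) := by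
    intro n
    rw [hsucc]
    refine measureReal_union ?_ ?_
    · exact Set.disjoint_left.2 fun ω h1 h2 => h2.1 h1
    · exact (hE' n).compl.inter
        (measurableSet_le measurable_const ((hmeas _ (by omega)).div_const _))
  have key : ∀ n, 1 ≤ n → lam * μ.real (E n) + (∫ ω in (E n)ᶜ, max (Y n ω) 0 ∂μ) / a n ≤
      (∫ ω, max (Y 1 ω) 0 ∂μ) / a 1 +
        ∑ i ∈ Finset.Ico 1 n,
          ((∫ ω, max (Y (i + 1) ω) 0 ∂μ) - ∫ ω, max (Y i ω) 0 ∂μ) / a (i + 1) := by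
    intro n hn
    induction n, hn using Nat.le_induction with
    | base =>
      have h0 : E 0 = ∅ := by
        ext ω
        simp only [E, Set.mem_ofPred_eq, Set.mem_empty_iff_false, iff_false]
        rintro ⟨i, h1, h2, _⟩
        omega
      have h := hrc_step (μ := μ) (Y 1) (hmeas 1 le_rfl) (hint 1 le_rfl) (a 1) lam
        (hapos 1 le_rfl) (E 0)ᶜ (hE' 0).compl
      have h1 := hmu 0
      have h2 := hcompl 0
      simp only [zero_add] at h1 h2
      rw [h1, h2]
      have h3 : ∫ ω in (E 0)ᶜ, max (Y 1 ω) 0 ∂μ = ∫ ω, max (Y 1 ω) 0 ∂μ := by simp [h0]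
      have h4 : μ.real (E 0) = 0 := by simp [h0]
      rw [h3] at h
      rw [h4]
      simpa using h
    | succ n hn ih =>
      have h := hrc_step (μ := μ) (Y (n + 1)) (hmeas _ (by omega)) (hint _ (by omega)) (a (n + 1)) lam
        (hapos _ (by omega)) (E n)ᶜ (hE' n).compl
      rw [hmu, hcompl, Finset.sum_Ico_succ_top hn]
      have h1 := hrc_sub ℱ Y hadp hint hsub n hn (E n) (hE n)
      have h2 := integral_add_compl (hE' n) (hX n hn)
      have h3 := integral_add_compl (hE' n) (hX (n + 1) (by omega))
      have h4 : (∫ ω in (E n)ᶜ, max (Y n ω) 0 ∂μ) / a (n + 1)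
          ≤ (∫ ω in (E n)ᶜ, max (Y n ω) 0 ∂μ) / a n :=
        div_le_div_of_nonneg_left (integral_nonneg fun ω => le_max_right _ _) (hapos n hn)
          (hamono n (n + 1) hn (by omega))
      have h5 : ((∫ ω in (E n)ᶜ, max (Y (n + 1) ω) 0 ∂μ) - ∫ ω in (E n)ᶜ, max (Y n ω) 0 ∂μ)
            / a (n + 1)
          ≤ ((∫ ω, max (Y (n + 1) ω) 0 ∂μ) - ∫ ω, max (Y n ω) 0 ∂μ) / a (n + 1) :=
        div_le_div_of_nonneg_right (by linarith) (hapos (n + 1) (by omega)).le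
      rw [sub_div] at h5
      linarith
  refine le_trans ?_ (key n hn)
  exact le_add_of_nonneg_right
    (div_nonneg (integral_nonneg fun ω => le_max_right _ _) (hapos n hn).le)
end

section
/- Chow's strong law of large numbers for p > 2: let (Ω, ℱ, μ) be a probability space with a filtration (ℱ_n)_{n ≥ 1}, let p > 2 be a real number, and let (Y_n)_{n ≥ 1} be a martingale difference sequence with respect to (ℱ_n) such that each |Y_n|^p is integrable. If Σ_{i=1}^∞ E[|Y_i|^p] / i^{1 + p/2} < ∞, then (1/n) · Σ_{i=1}^n Y_i → 0 almost everywhere as n → ∞. -/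
open MeasureTheory Filter Topology

lemma chow_aux_one (p : ℝ) (hp : 2 < p) : ∃ C : ℝ, 1 ≤ C ∧ ∀ n : ℝ, 1 ≤ n → ∀ t : ℝ,
    |1 + t| ^ p ≤ 1 + 1 / (2 * n) + p * t + C * n ^ (p / 2 - 1) * |t| ^ p := by
  have h1 : (1:ℝ) ≤ (p + 1) ^ p := Real.one_le_rpow (by linarith) (by linarith)
  have h2 : 0 ≤ p ^ p := by positivity
  have h3 : 0 ≤ p ^ 2 * (2 * p ^ 2) ^ (p / 2 - 1) := by positivity
  refine ⟨(p + 1) ^ p + p ^ p + p ^ 2 * (2 * p ^ 2) ^ (p / 2 - 1), by linarith, ?_⟩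
  intro n hn t
  have hn0 : 0 < n := by linarith
  have hnp : 1 ≤ n ^ (p / 2 - 1) := Real.one_le_rpow hn (by linarith)
  have ht0 : 0 ≤ |t| ^ p := by positivity
  have hinv : 0 < 1 / (2 * n) := by positivity
  rcases le_or_gt |p * t| 1 with hs | hs
  · have habs : |t| ≤ 1 := by
      rw [abs_mul, abs_of_pos (by linarith : (0:ℝ) < p)] at hs
      nlinarith [abs_nonneg t]
    have hnn : 0 ≤ 1 + t := by linarith [neg_abs_le t]
    have hexp : |1 + t| ^ p ≤ 1 + p * t + (p * t) ^ 2 := by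
      rw [abs_of_nonneg hnn]
      calc (1 + t) ^ p ≤ (Real.exp t) ^ p :=
            Real.rpow_le_rpow hnn (by linarith [Real.add_one_le_exp t]) (by linarith)
        _ = Real.exp (p * t) := by rw [← Real.exp_mul, mul_comm]
        _ ≤ _ := by
            have := Real.abs_exp_sub_one_sub_id_le hs
            linarith [le_abs_self (Real.exp (p * t) - 1 - p * t)]
    have key : (p * t) ^ 2 ≤ 1 / (2 * n) +
        (p ^ 2 * (2 * p ^ 2) ^ (p / 2 - 1)) * n ^ (p / 2 - 1) * |t| ^ p := by
      rcases le_or_gt ((p * t) ^ 2) (1 / (2 * n)) with h | h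
      · have : 0 ≤ (p ^ 2 * (2 * p ^ 2) ^ (p / 2 - 1)) * n ^ (p / 2 - 1) * |t| ^ p := by positivity
        linarith
      · have h' : 1 ≤ 2 * p ^ 2 * n * |t| ^ 2 := by
          rw [div_lt_iff₀ (by positivity)] at h
          rw [sq_abs]; nlinarith
        have h4 : 1 ≤ (2 * p ^ 2 * n * |t| ^ 2) ^ (p / 2 - 1) := Real.one_le_rpow h' (by linarith)
        have h5 : (2 * p ^ 2 * n * |t| ^ 2) ^ (p / 2 - 1)
            = (2 * p ^ 2) ^ (p / 2 - 1) * n ^ (p / 2 - 1) * |t| ^ (p - 2) := by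
          rw [Real.mul_rpow (by positivity) (by positivity),
            Real.mul_rpow (by positivity) (by positivity), ← Real.rpow_natCast |t| 2,
            ← Real.rpow_mul (abs_nonneg t)]
          congr 2
          push_cast; ring
        have h6 : |t| ^ p = |t| ^ (p - 2) * t ^ 2 := by
          rw [← sq_abs t, ← Real.rpow_natCast |t| 2, ← Real.rpow_add']
          · congr 1; push_cast; ring
          · exact abs_nonneg t
          · push_cast; linarith
        rw [h5] at h4
        rw [h6]
        have h7 : 0 ≤ (p * t) ^ 2 := sq_nonneg _
        nlinarith [mul_le_mul_of_nonneg_left h4 h7]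
    have : 0 ≤ ((p + 1) ^ p + p ^ p) * n ^ (p / 2 - 1) * |t| ^ p := by positivity
    nlinarith
  · have hpt : 1 < p * |t| := by
      rwa [abs_mul, abs_of_pos (by linarith : (0:ℝ) < p)] at hs
    have e1 : |1 + t| ^ p ≤ (p + 1) ^ p * |t| ^ p := by
      rw [← Real.mul_rpow (by linarith) (abs_nonneg t)]
      refine Real.rpow_le_rpow (abs_nonneg _) ?_ (by linarith)
      have := abs_add_le 1 t
      rw [abs_one] at this
      linarith
    have e2 : p * |t| ≤ p ^ p * |t| ^ p := by
      rw [← Real.mul_rpow (by linarith) (abs_nonneg t)]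
      exact Real.self_le_rpow_of_one_le hpt.le (by linarith)
    have e3 : -(p * t) ≤ p * |t| := by nlinarith [neg_abs_le t]
    have e4 : ((p + 1) ^ p + p ^ p) * |t| ^ p ≤
        ((p + 1) ^ p + p ^ p) * |t| ^ p * n ^ (p / 2 - 1) :=
      le_mul_of_one_le_right (by positivity) hnp
    have : 0 ≤ (p ^ 2 * (2 * p ^ 2) ^ (p / 2 - 1)) * n ^ (p / 2 - 1) * |t| ^ p := by positivity
    nlinarith

lemma chow_aux_two (p : ℝ) (hp : 2 < p) : ∃ C : ℝ, 1 ≤ C ∧ ∀ n : ℝ, 1 ≤ n → ∀ a b : ℝ,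
    |a + b| ^ p ≤ (1 + 1 / (2 * n)) * |a| ^ p + p * (a * |a| ^ (p - 2)) * b
      + C * n ^ (p / 2 - 1) * |b| ^ p := by
  obtain ⟨C, hC, h⟩ := chow_aux_one p hp
  refine ⟨C, hC, fun n hn a b => ?_⟩
  rcases eq_or_ne a 0 with rfl | ha
  · have hnp : 1 ≤ n ^ (p / 2 - 1) := Real.one_le_rpow hn (by linarith)
    have : 1 ≤ C * n ^ (p / 2 - 1) := one_le_mul_of_one_le_of_one_le hC hnp
    have h0 : (0:ℝ) ^ p = 0 := Real.zero_rpow (by linarith)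
    simp only [abs_zero, h0, zero_add, mul_zero, zero_mul]
    exact le_mul_of_one_le_left (by positivity) this
  · have h1 := mul_le_mul_of_nonneg_left (h n hn (b / a)) (by positivity : 0 ≤ |a| ^ p)
    rw [← Real.mul_rpow (abs_nonneg _) (abs_nonneg _), ← abs_mul] at h1
    have e1 : a * (1 + b / a) = a + b := by field_simp
    have e2 : |a| ^ p * |b / a| ^ p = |b| ^ p := by
      rw [← Real.mul_rpow (abs_nonneg _) (abs_nonneg _), ← abs_mul]
      congr 2; field_simp
    have e3 : |a| ^ p * (b / a) = a * |a| ^ (p - 2) * b := by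
      have : |a| ^ p = |a| ^ (p - 2) * a ^ 2 := by
        rw [← sq_abs a, ← Real.rpow_natCast |a| 2, ← Real.rpow_add (abs_pos.2 ha)]
        congr 1; push_cast; ring
      rw [this]; field_simp
    rw [e1] at h1
    calc _ ≤ _ := h1
      _ = (1 + 1 / (2 * n)) * |a| ^ p + p * (|a| ^ p * (b / a))
          + C * n ^ (p / 2 - 1) * (|a| ^ p * |b / a| ^ p) := by ring
      _ = _ := by rw [e2, e3]; ring

lemma chow_aux_det (x e : ℕ → ℝ) (hx : ∀ k, 0 ≤ x k)
    (h : ∀ k, x (k + 1) ≤ x k * (1 - 1 / (2 * ((k : ℝ) + 1))) + e k)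
    (he : ∃ l, Tendsto (fun n => ∑ k ∈ Finset.range n, e k) atTop (𝓝 l)) :
    Tendsto x atTop (𝓝 0) := by
  obtain ⟨l, hl⟩ := he
  set T : ℕ → ℝ := fun n => ∑ k ∈ Finset.range n, e k with hT
  set A : ℕ → ℝ := fun n => ∑ k ∈ Finset.range n, x k * (1 / (2 * ((k : ℝ) + 1))) with hA
  have hterm : ∀ k, 0 ≤ x k * (1 / (2 * ((k : ℝ) + 1))) := fun k =>
    mul_nonneg (hx k) (by positivity)
  have hA0 : ∀ n, 0 ≤ A n := fun n => Finset.sum_nonneg fun k _ => hterm k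
  obtain ⟨B, hB⟩ := hl.bddAbove_range
  have hBT : ∀ n, T n ≤ B := fun n => hB ⟨n, rfl⟩
  have hV : Antitone (fun n => x n + A n - T n) := by
    refine antitone_nat_of_succ_le fun n => ?_
    simp only [hA, hT, Finset.sum_range_succ]
    have := h n
    linarith
  have hVb : BddBelow (Set.range (fun n => x n + A n - T n)) := by
    refine ⟨-B, ?_⟩
    rintro _ ⟨n, rfl⟩
    have := hx n; have := hA0 n; have := hBT n
    simp only; linarith
  have hVlim := tendsto_atTop_ciInf hV hVb
  set v := ⨅ n, (x n + A n - T n)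
  have hxA : Tendsto (fun n => x n + A n) atTop (𝓝 (v + l)) := by
    have := hVlim.add hl
    refine this.congr fun n => ?_
    ring
  obtain ⟨B', hB'⟩ := hxA.bddAbove_range
  have hsum : Summable (fun k : ℕ => x k * (1 / (2 * ((k : ℝ) + 1)))) := by
    refine summable_of_sum_range_le (c := B') hterm fun n => ?_
    have : x n + A n ≤ B' := hB' ⟨n, rfl⟩
    have := hx n
    change A n ≤ B'
    linarith
  have hAlim := hsum.hasSum.tendsto_sum_nat
  have hxlim : Tendsto x atTop (𝓝 (v + l - ∑' k : ℕ, x k * (1 / (2 * ((k : ℝ) + 1))))) := by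
    refine (hxA.sub hAlim).congr fun n => ?_
    simp only [hA]; ring
  set r := v + l - ∑' k : ℕ, x k * (1 / (2 * ((k : ℝ) + 1)))
  have hr : 0 ≤ r := ge_of_tendsto' hxlim hx
  rcases hr.eq_or_lt with h0 | h0
  · rwa [← h0] at hxlim
  · exfalso
    obtain ⟨N, hN⟩ := eventually_atTop.1 (hxlim.eventually (lt_mem_nhds (half_lt_self h0)))
    have hs2 : Summable (fun k : ℕ => 1 / (((k + N + 1 : ℕ) : ℝ))) := by
      have := ((summable_nat_add_iff N).2 hsum).mul_left (4 / r)
      refine this.of_nonneg_of_le (fun k => by positivity) fun k => ?_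
      have h1 := hN (k + N) (by omega)
      have hk : (0:ℝ) < ((k + N : ℕ) : ℝ) + 1 := by positivity
      push_cast at hk h1 ⊢
      have : 4 / r * (x (k + N) * (1 / (2 * ((k:ℝ) + N + 1))))
        = (2 * x (k + N) / r) * (1 / ((k:ℝ) + N + 1)) := by field_simp; ring
      rw [this]
      refine le_mul_of_one_le_left (by positivity) ?_
      rw [le_div_iff₀ h0]; linarith
    have := (summable_nat_add_iff (f := fun k : ℕ => 1 / (k : ℝ)) (N + 1)).1 hs2
    exact Real.not_summable_one_div_natCast this

lemma chow_aux_young (p : ℝ) (hp : 2 < p) (a b : ℝ) (ha : 0 ≤ a) (hb : 0 ≤ b) :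
    a * a ^ (p - 2) * b ≤ a ^ p + b ^ p := by
  have key : ∀ c : ℝ, 0 ≤ c → c * c ^ (p - 2) * c = c ^ p := by
    intro c hc
    rcases hc.eq_or_lt with rfl | hc
    · simp [Real.zero_rpow (by linarith : p ≠ 0)]
    · have : c ^ p = c ^ (p - 2) * c ^ 2 := by
        rw [← Real.rpow_natCast c 2, ← Real.rpow_add hc]
        congr 1; push_cast; ring
      rw [this]; ring
  have h1 : 0 ≤ a ^ p := by positivity
  have h2 : 0 ≤ b ^ p := by positivity
  rcases le_total a b with h | h
  · have : a * a ^ (p - 2) * b ≤ b * b ^ (p - 2) * b := by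
      have := Real.rpow_le_rpow ha h (by linarith : 0 ≤ p - 2)
      gcongr
    rw [key b hb] at this
    linarith
  · have : a * a ^ (p - 2) * b ≤ a * a ^ (p - 2) * a := by gcongr
    rw [key a ha] at this
    linarith

/-- Chow's strong law of large numbers for `p > 2`. -/
theorem chow_strong_law_of_large_numbers_p_gt_two
    {Ω : Type*} {m0 : MeasurableSpace Ω} {μ : Measure Ω} [IsProbabilityMeasure μ]
    (ℱ : Filtration ℕ m0) (p : ℝ) (hp : 2 < p) (Y : ℕ → Ω → ℝ)
    (hint : ∀ n, 1 ≤ n → Integrable (Y n) μ)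
    (hadp : ∀ n, 1 ≤ n → StronglyMeasurable[ℱ n] (Y n))
    (hmds : ∀ n, 2 ≤ n → μ[Y n | ℱ (n - 1)] =ᵐ[μ] 0)
    (hYp : ∀ n, 1 ≤ n → Integrable (fun ω => |Y n ω| ^ p) μ)
    (hsum : Summable fun i : ℕ =>
      (∫ ω, |Y (i + 1) ω| ^ p ∂μ) / ((i + 1 : ℕ) : ℝ) ^ (1 + p / 2)) :
    ∀ᵐ ω ∂μ, Tendsto (fun n : ℕ => (n : ℝ)⁻¹ * ∑ i ∈ Finset.Icc 1 n, Y i ω) atTop (𝓝 0) := by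
  obtain ⟨C, hC, hineq⟩ := chow_aux_two p hp
  have hp0 : 0 < p := by linarith
  set S : ℕ → Ω → ℝ := fun n ω => ∑ i ∈ Finset.Icc 1 n, Y i ω with hS
  have hSsucc : ∀ n ω, S (n + 1) ω = S n ω + Y (n + 1) ω := fun n ω => by
    simp only [hS]; rw [Finset.sum_Icc_succ_top (by omega)]
  have hS0 : ∀ ω, S 0 ω = 0 := fun ω => by simp [hS]
  have hSmeas : ∀ n, StronglyMeasurable[ℱ n] (S n) := by
    intro n
    refine Finset.stronglyMeasurable_fun_sum _ fun i hi => ?_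
    rw [Finset.mem_Icc] at hi
    exact (hadp i hi.1).mono (ℱ.mono hi.2)
  have hpE0 : ENNReal.ofReal p ≠ 0 := by simpa using hp0
  have hpEr : (ENNReal.ofReal p).toReal = p := ENNReal.toReal_ofReal hp0.le
  have hYmem : ∀ n, 1 ≤ n → MemLp (Y n) (ENNReal.ofReal p) μ := by
    intro n hn
    rw [← integrable_norm_rpow_iff (hint n hn).1 hpE0 ENNReal.ofReal_ne_top, hpEr]
    exact hYp n hn
  have hSp : ∀ n, Integrable (fun ω => |S n ω| ^ p) μ := by
    intro n
    have : MemLp (S n) (ENNReal.ofReal p) μ :=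
      memLp_finsetSum _ fun i hi => hYmem i (Finset.mem_Icc.1 hi).1
    have := this.integrable_norm_rpow hpE0 ENNReal.ofReal_ne_top
    rwa [hpEr] at this
  -- the martingale
  set g : ℕ → Ω → ℝ := fun k ω => p * (S k ω * |S k ω| ^ (p - 2)) / ((k : ℝ) + 1) ^ p with hg
  have hgmeas : ∀ k, StronglyMeasurable[ℱ k] (g k) := by
    intro k
    have h1 : Measurable[ℱ k] (S k) := (hSmeas k).measurable
    have h2 : Measurable[ℱ k] (fun ω => |S k ω| ^ (p - 2)) := by
      have : Measurable (fun x : ℝ => |x| ^ (p - 2)) := by fun_prop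
      exact this.comp h1
    exact (((h1.mul h2).const_mul p).div_const _).stronglyMeasurable
  have hgY : ∀ k, Integrable (g k * Y (k + 1)) μ := by
    intro k
    have hb := (((hSp k).add (hYp (k + 1) (by omega))).const_mul p).div_const (((k : ℝ) + 1) ^ p)
    refine hb.mono' ((((hgmeas k).mono (ℱ.le k)).aestronglyMeasurable).mul
      (hint (k + 1) (by omega)).1) (ae_of_all _ fun ω => ?_)
    simp only [Pi.mul_apply, Pi.add_apply, hg, Real.norm_eq_abs]
    rw [div_mul_eq_mul_div, abs_div, abs_of_nonneg (by positivity : 0 ≤ ((k : ℝ) + 1) ^ p)]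
    gcongr
    rw [mul_assoc, abs_mul, abs_of_pos hp0]
    gcongr
    rw [abs_mul, abs_mul, abs_of_nonneg (by positivity : 0 ≤ |S k ω| ^ (p - 2))]
    exact chow_aux_young p hp _ _ (abs_nonneg _) (abs_nonneg _)
  set M : ℕ → Ω → ℝ := fun n => ∑ k ∈ Finset.range n, g k * Y (k + 1) with hM
  have hMint : ∀ n, Integrable (M n) μ := fun n => integrable_finsetSum' _ fun k _ => hgY k
  have hMart : Martingale M ℱ μ := by
    refine martingale_of_condExp_sub_eq_zero_nat ?_ hMint fun k => ?_
    · intro n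
      refine Finset.stronglyMeasurable_sum _ fun k hk => ?_
      have hk := Finset.mem_range.1 hk
      exact ((hgmeas k).mono (ℱ.mono hk.le)).mul ((hadp (k + 1) (by omega)).mono (ℱ.mono hk))
    · have e : M (k + 1) - M k = g k * Y (k + 1) := by
        simp only [hM, Finset.sum_range_succ]; simp
      rw [e]
      refine (condExp_mul_of_stronglyMeasurable_left (hgmeas k) (hgY k)
        (hint (k + 1) (by omega))).trans ?_
      rcases Nat.eq_zero_or_pos k with rfl | hk
      · have : g 0 = 0 := by funext ω; simp [hg, hS0]
        rw [this, zero_mul]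
      · have := hmds (k + 1) (by omega)
        rw [Nat.add_sub_cancel] at this
        filter_upwards [this] with ω hω
        simp [hω]
  -- the perturbation
  set D : ℕ → Ω → ℝ := fun k ω => C * (|Y (k + 1) ω| ^ p / ((k + 1 : ℕ) : ℝ) ^ (1 + p / 2)) with hD
  have hD0 : ∀ k ω, 0 ≤ D k ω := fun k ω => by positivity
  have hDint : ∀ k, Integrable (D k) μ := fun k =>
    ((hYp (k + 1) (by omega)).div_const _).const_mul C
  have hDsum : Summable fun k => ∫ ω, D k ω ∂μ := by
    have := hsum.mul_left C
    refine this.congr fun k => ?_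
    simp only [hD]
    rw [integral_const_mul, integral_div]
  set X : ℕ → Ω → ℝ := fun k ω => |S k ω| ^ p / (k : ℝ) ^ p with hX
  have hX0 : ∀ k ω, 0 ≤ X k ω := fun k ω => by positivity
  have hstep : ∀ k ω, X (k + 1) ω ≤ X k ω * (1 - 1 / (2 * ((k : ℝ) + 1)))
      + (g k ω * Y (k + 1) ω + D k ω) := by
    intro k ω
    have hn : (1:ℝ) ≤ (k : ℝ) + 1 := by linarith [Nat.cast_nonneg (α := ℝ) k]
    have hn0 : (0:ℝ) < (k : ℝ) + 1 := by linarith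
    have hnp : 0 < ((k : ℝ) + 1) ^ p := by positivity
    have h1 := div_le_div_of_nonneg_right (hineq _ hn (S k ω) (Y (k + 1) ω)) hnp.le
    have e1 : ((k : ℝ) + 1) ^ (p / 2 - 1) / ((k : ℝ) + 1) ^ p
        = 1 / ((k : ℝ) + 1) ^ (1 + p / 2) := by
      rw [← Real.rpow_sub hn0, one_div, ← Real.rpow_neg hn0.le]
      congr 1; ring
    have e2 : |S k ω| ^ p / ((k : ℝ) + 1) ^ p * (1 + 1 / (2 * ((k : ℝ) + 1)))
        ≤ X k ω * (1 - 1 / (2 * ((k : ℝ) + 1))) := by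
      rcases Nat.eq_zero_or_pos k with rfl | hk
      · simp [hX, hS0, Real.zero_rpow hp0.ne']
      · have hk0 : (0:ℝ) < k := by exact_mod_cast hk
        have e3 : |S k ω| ^ p / ((k : ℝ) + 1) ^ p = X k ω * ((k : ℝ) / (k + 1)) ^ p := by
          rw [Real.div_rpow hk0.le hn0.le]
          simp only [hX]
          have : (0:ℝ) < (k:ℝ) ^ p := by positivity
          field_simp
        have e4 : ((k : ℝ) / (k + 1)) ^ p ≤ (k : ℝ) / (k + 1) :=
          Real.rpow_le_self_of_le_one (by positivity) (by rw [div_le_one hn0]; linarith)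
            (by linarith)
        rw [e3, mul_assoc]
        refine mul_le_mul_of_nonneg_left ?_ (hX0 k ω)
        refine (mul_le_mul_of_nonneg_right e4 (by positivity)).trans ?_
        rw [← sub_nonneg]
        have : 1 - 1 / (2 * ((k : ℝ) + 1)) - (k : ℝ) / (k + 1) * (1 + 1 / (2 * ((k : ℝ) + 1)))
          = 1 / (2 * ((k : ℝ) + 1) ^ 2) := by field_simp; ring
        rw [this]; positivity
    have e5 : ((1 + 1 / (2 * ((k : ℝ) + 1))) * |S k ω| ^ p
        + p * (S k ω * |S k ω| ^ (p - 2)) * Y (k + 1) ω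
        + C * ((k : ℝ) + 1) ^ (p / 2 - 1) * |Y (k + 1) ω| ^ p) / ((k : ℝ) + 1) ^ p
        = |S k ω| ^ p / ((k : ℝ) + 1) ^ p * (1 + 1 / (2 * ((k : ℝ) + 1)))
          + (g k ω * Y (k + 1) ω
          + C * |Y (k + 1) ω| ^ p * (((k : ℝ) + 1) ^ (p / 2 - 1) / ((k : ℝ) + 1) ^ p)) := by
      simp only [hg]; ring
    rw [e5, e1] at h1
    have e6 : D k ω = C * |Y (k + 1) ω| ^ p * (1 / ((k : ℝ) + 1) ^ (1 + p / 2)) := by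
      simp only [hD]; push_cast; ring
    have e7 : X (k + 1) ω = |S k ω + Y (k + 1) ω| ^ p / ((k : ℝ) + 1) ^ p := by
      simp only [hX, hSsucc]; push_cast; rfl
    rw [e6, e7]
    linarith
  have hMapp : ∀ n ω, M n ω = ∑ k ∈ Finset.range n, g k ω * Y (k + 1) ω := fun n ω => by
    simp [hM]
  have hlow : ∀ n ω, X n ω ≤ M n ω + ∑ k ∈ Finset.range n, D k ω := by
    intro n ω
    induction n with
    | zero => simp [hMapp, hX, hS0, Real.zero_rpow hp0.ne']
    | succ n ih =>
      have h1 := hstep n ω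
      have h2 : 0 ≤ X n ω * (1 / (2 * ((n : ℝ) + 1))) := mul_nonneg (hX0 n ω) (by positivity)
      rw [hMapp, Finset.sum_range_succ, Finset.sum_range_succ, ← hMapp]
      linarith
  have hM0 : ∀ n, ∫ ω, M n ω ∂μ = 0 := by
    intro n
    have h1 := hMart.setIntegral_eq (Nat.zero_le n) (MeasurableSet.univ)
    simp only [setIntegral_univ] at h1
    rw [← h1]; simp [hM]
  have hMbdd : ∀ n, eLpNorm (M n) 1 μ ≤ ((2 * ∑' k, ∫ ω, D k ω ∂μ).toNNReal : ENNReal) := by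
    intro n
    rw [eLpNorm_one_eq_lintegral_enorm, ← ofReal_integral_norm_eq_lintegral_enorm (hMint n)]
    refine ENNReal.ofReal_le_ofReal ?_
    have hDs : Integrable (fun ω => ∑ k ∈ Finset.range n, D k ω) μ :=
      integrable_finsetSum _ fun k _ => hDint k
    calc ∫ ω, ‖M n ω‖ ∂μ ≤ ∫ ω, (M n ω + 2 * ∑ k ∈ Finset.range n, D k ω) ∂μ := by
          refine integral_mono (hMint n).norm ((hMint n).add (hDs.const_mul 2)) fun ω => ?_
          have h1 := hlow n ω
          have h2 := hX0 n ω
          have h3 : 0 ≤ ∑ k ∈ Finset.range n, D k ω := Finset.sum_nonneg fun k _ => hD0 k ω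
          simp only [Real.norm_eq_abs]
          rw [abs_le]; constructor <;> linarith
      _ = 2 * ∑ k ∈ Finset.range n, ∫ ω, D k ω ∂μ := by
          rw [integral_add (hMint n) (hDs.const_mul 2), hM0, integral_const_mul,
            integral_finsetSum _ fun k _ => hDint k, zero_add]
      _ ≤ _ := by
          gcongr
          exact hDsum.sum_le_tsum _ fun k _ => integral_nonneg (hD0 k)
  have hMconv := hMart.submartingale.exists_ae_tendsto_of_bdd hMbdd
  have hDconv : ∀ᵐ ω ∂μ, Summable fun k => D k ω := by
    have h1 : ∑' k, eLpNorm (D k) 1 μ ≠ ⊤ := by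
      have h2 : ∀ k, eLpNorm (D k) 1 μ = ENNReal.ofReal (∫ ω, D k ω ∂μ) := by
        intro k
        rw [eLpNorm_one_eq_lintegral_enorm, ← ofReal_integral_norm_eq_lintegral_enorm (hDint k)]
        congr 1
        exact integral_congr_ae (ae_of_all _ fun ω => Real.norm_of_nonneg (hD0 k ω))
      simp_rw [h2]
      rw [← ENNReal.ofReal_tsum_of_nonneg (fun k => integral_nonneg (hD0 k)) hDsum]
      exact ENNReal.ofReal_ne_top
    filter_upwards [summable_norm_of_tsum_eLpNorm_ne_top le_rfl (fun k => (hDint k).1) h1] with ω hω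
    exact hω.of_norm
  filter_upwards [hMconv, hDconv] with ω ⟨c, hc⟩ hd
  have hXlim : Tendsto (fun k => X k ω) atTop (𝓝 0) := by
    refine chow_aux_det _ _ (fun k => hX0 k ω) (fun k => hstep k ω)
      ⟨c + ∑' k, D k ω, (hc.add hd.hasSum.tendsto_sum_nat).congr fun n => ?_⟩
    rw [Finset.sum_add_distrib, hMapp]
  have h2 := hXlim.rpow_const (p := p⁻¹) (Or.inr (by positivity))
  rw [Real.zero_rpow (by positivity)] at h2
  rw [tendsto_zero_iff_norm_tendsto_zero]
  refine h2.congr fun n => ?_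
  simp only [hX]
  rw [← Real.div_rpow (abs_nonneg _) (Nat.cast_nonneg n), Real.rpow_rpow_inv (by positivity) hp0.ne',
    norm_mul, norm_inv, Real.norm_natCast, Real.norm_eq_abs, div_eq_inv_mul]
end
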